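/- For every integer n ≥ 0, Σ_{j=0}^{∞} (−1)^{T_j} Q(n − G_j) equals (−1)^{T_m} if n = 2G_m for some (necessarily unique) integer m ≥ 0, and equals 0 otherwise; the sum is finite since Q vanishes on negative arguments. -/

import Mathlib

/-- The `n`-th triangular number `T n = n(n+1)/2`. -/
def T (n : ℕ) : ℕ := n * (n + 1) / 2

/-- The `n`-th generalized pentagonal number `G n = T n - T ⌊n/2⌋`. -/
def G (n : ℕ) : ℕ := T n - T (n / 2)

/-- The number of partitions of `n` into distinct parts, vanishing on negative integers. -/
def Q (n : ℤ) : ℤ :=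
  if 0 ≤ n then ((Nat.Partition.distincts n.toNat).card : ℤ) else 0

open Classical in
/-- `ε(n) = (-1)^(T m)` if `n = 2 G m` for the (unique) `m`, and `0` otherwise. -/
noncomputable def eps (n : ℕ) : ℤ := if h : ∃ m, n = 2 * G m then (-1) ^ (T h.choose) else 0

open PowerSeries PowerSeries.WithPiTopology

lemma two_mul_T (n : ℕ) : 2 * T n = n * (n + 1) :=
  Nat.mul_div_cancel' (Nat.even_mul_succ_self n).two_dvd

/-- The enumeration `0, 1, -1, 2, -2, …` of the integers, along which pentagonal numbers increase. -/
def pentagonalIndex (j : ℕ) : ℤ := if Even j then -((j / 2 : ℕ) : ℤ) else ((j / 2 : ℕ) : ℤ) + 1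

lemma pentagonalIndex_two_mul (k : ℕ) : pentagonalIndex (2 * k) = -k := by
  simp [pentagonalIndex]

lemma pentagonalIndex_two_mul_add_one (k : ℕ) : pentagonalIndex (2 * k + 1) = k + 1 := by
  have : (2 * k + 1) / 2 = k := by omega
  simp [pentagonalIndex, this]

lemma bijective_pentagonalIndex : Function.Bijective pentagonalIndex := by
  constructor
  · intro a b h
    obtain ⟨x, rfl | rfl⟩ := Nat.even_or_odd' a <;> obtain ⟨y, rfl | rfl⟩ := Nat.even_or_odd' b <;>
      simp only [pentagonalIndex_two_mul, pentagonalIndex_two_mul_add_one] at h <;> omega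
  · intro k
    obtain hk | hk := le_or_gt k 0
    · exact ⟨2 * k.natAbs, by rw [pentagonalIndex_two_mul]; omega⟩
    · exact ⟨2 * (k.natAbs - 1) + 1, by rw [pentagonalIndex_two_mul_add_one]; omega⟩

lemma pentagonal_pentagonalIndex (j : ℕ) : pentagonal (pentagonalIndex j) = G j := by
  have hp := two_mul_natCast_pentagonal (pentagonalIndex j)
  have h₁ := two_mul_T j
  have h₂ := two_mul_T (j / 2)
  have hle : T (j / 2) ≤ T j := by
    have : j / 2 * (j / 2 + 1) ≤ j * (j + 1) := by gcongr <;> omega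
    omega
  suffices (pentagonal (pentagonalIndex j) : ℤ) = T j - T (j / 2) by rw [G]; omega
  obtain ⟨k, rfl | rfl⟩ := Nat.even_or_odd' j
  · rw [pentagonalIndex_two_mul] at hp ⊢
    rw [show 2 * k / 2 = k by omega] at h₂ ⊢
    zify at h₁ h₂
    linarith
  · rw [pentagonalIndex_two_mul_add_one] at hp ⊢
    rw [show (2 * k + 1) / 2 = k by omega] at h₂ ⊢
    zify at h₁ h₂
    linarith

lemma negOnePow_pentagonalIndex (j : ℕ) :
    ((pentagonalIndex j).negOnePow : ℤ) = (-1) ^ T j := by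
  have h := two_mul_T j
  obtain ⟨k, rfl | rfl⟩ := Nat.even_or_odd' j
  · rw [show T (2 * k) = 2 * (k * k) + k by linarith, pow_add, pow_mul,
      pentagonalIndex_two_mul, Int.negOnePow_neg]
    simpa using Int.coe_negOnePow_natCast k
  · rw [show T (2 * k + 1) = 2 * (k * k + k) + (k + 1) by linarith, pow_add, pow_mul,
      pentagonalIndex_two_mul_add_one]
    simpa using Int.coe_negOnePow_natCast (k + 1)

lemma coeff_pentagonalSeries_G (m : ℕ) : (pentagonalSeries ℤ).coeff (G m) = (-1) ^ T m := by
  rw [← pentagonal_pentagonalIndex, coeff_pentagonalSeries_pentagonal, ← negOnePow_pentagonalIndex,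
    Int.cast_id]

lemma range_G : Set.range G = Set.range pentagonal := by
  rw [← bijective_pentagonalIndex.surjective.range_comp pentagonal]
  exact congrArg Set.range (funext fun j ↦ (pentagonal_pentagonalIndex j).symm)

lemma hasSum_pow_G : HasSum (fun j ↦ C ((-1 : ℤ) ^ T j) * X ^ G j) (pentagonalSeries ℤ) := by
  convert (Equiv.ofBijective _ bijective_pentagonalIndex).hasSum_iff.mpr
    (hasSum_pentagonalSeries ℤ) using 2 with j
  simp [pentagonal_pentagonalIndex, ← negOnePow_pentagonalIndex]

lemma continuous_expand {R : Type*} [CommRing R] [TopologicalSpace R] (p : ℕ) (hp : p ≠ 0) :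
    Continuous (expand p hp : R⟦X⟧ →ₐ[R] R⟦X⟧) := by
  refine continuous_iff_continuousAt.mpr fun f ↦ (tendsto_iff_coeff_tendsto R _ _ _).mpr fun d ↦ ?_
  simp only [coeff_expand]
  split_ifs
  · exact (continuous_coeff R _).continuousAt
  · exact tendsto_const_nhds

/-- Euler's product `∏ (1 + X ^ i) * ∏ (1 - X ^ i) = ∏ (1 - X ^ (2 * i))` in terms of series. -/
lemma distincts_mul_pentagonalSeries :
    (PowerSeries.mk fun n ↦ ((Nat.Partition.distincts n).card : ℤ)) * pentagonalSeries ℤ =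
      expand 2 two_ne_zero (pentagonalSeries ℤ) := by
  have hD := Nat.Partition.hasProd_powerSeriesMk_card_countRestricted ℤ two_pos
  simp only [Nat.Partition.countRestricted_two] at hD
  have hE := (hasProd_one_sub_X_pow ℤ).map
    (expand 2 two_ne_zero : ℤ⟦X⟧ →ₐ[ℤ] ℤ⟦X⟧) (continuous_expand 2 two_ne_zero)
  refine (hD.mul (hasProd_one_sub_X_pow ℤ)).unique (hE.congr_fun fun i ↦ ?_)
  have h : ∑ j ∈ Finset.range 2, (X : ℤ⟦X⟧) ^ ((i + 1) * j) = 1 + X ^ (i + 1) := by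
    simp [Finset.sum_range_succ]
  refine (congrArg (· * (1 - X ^ (i + 1) : ℤ⟦X⟧)) h).trans ?_
  simp only [Function.comp_apply, map_sub, map_one, map_pow, expand_X]
  ring

lemma coeff_expand_pentagonalSeries (n : ℕ) :
    (expand 2 two_ne_zero (pentagonalSeries ℤ)).coeff n = eps n := by
  unfold eps
  split_ifs with h
  · conv_lhs => rw [h.choose_spec]
    rw [coeff_expand_mul, coeff_pentagonalSeries_G]
  · rw [coeff_expand]
    split_ifs with hn
    · refine coeff_pentagonalSeries_eq_zero ℤ ?_
      rw [← range_G]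
      rintro ⟨m, hm⟩
      exact h ⟨m, by omega⟩
    · rfl

theorem stmt_13 (n : ℕ) :
    ∑' j : ℕ, (-1 : ℤ) ^ (T j) * Q ((n : ℤ) - (G j : ℤ)) = eps n := by
  rw [← coeff_expand_pentagonalSeries, ← distincts_mul_pentagonalSeries, mul_comm]
  refine (((hasSum_iff_hasSum_coeff ℤ).mp
    (hasSum_pow_G.mul_right _) n).congr_fun fun j ↦ ?_).tsum_eq
  rw [mul_assoc, coeff_C_mul, coeff_X_pow_mul', Q]
  congr 1
  rw [show ((n : ℤ) - G j).toNat = n - G j by omega]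
  simp
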